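/- Let (ΛV, d) be a pure minimal Sullivan algebra with finite-dimensional V and finite-dimensional cohomology (formal dimension d). If (ΛV, d) is formal, then it is isomorphic to a tensor product (ΛV′, d) ⊗ (Λ⟨x₁,...,xₖ⟩, 0) where (ΛV′, d) is elliptic with positive Euler characteristic and the x_i have odd degrees. -/

import Mathlib

open MvPolynomial

noncomputable section

variable (n m : ℕ)

/-- The underlying algebra of a pure Sullivan algebra with `n` (even-degree) polynomial
generators and `m` (odd-degree) exterior generators: the exterior algebra on `m` generators
over `Q = ℚ[q₁,…,qₙ]`. -/
abbrev PureSullivanAlgebra : Type :=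
  ExteriorAlgebra (MvPolynomial (Fin n) ℚ) (Fin m → MvPolynomial (Fin n) ℚ)

/-- The differential of a pure Sullivan algebra, determined by `d xⱼ = Pⱼ` on the odd
generators and `d = 0` on `Q`: contraction against the functional `v ↦ ∑ vⱼ Pⱼ`. -/
def pureDiff (P : Fin m → MvPolynomial (Fin n) ℚ) :
    PureSullivanAlgebra n m →ₗ[MvPolynomial (Fin n) ℚ] PureSullivanAlgebra n m :=
  CliffordAlgebra.contractLeft
    (Q := (0 : QuadraticForm (MvPolynomial (Fin n) ℚ) (Fin m → MvPolynomial (Fin n) ℚ)))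
    (∑ j : Fin m, P j • LinearMap.proj j)

/-- `π : A →+* T` is a quasi-isomorphism from the differential graded algebra `(A, d)` to its
cohomology `(T, 0)` (with zero differential). -/
def DGQuasiIsoToZero {A T : Type*} [Ring A] [Ring T] (d : A → A) (π : A →+* T) : Prop :=
  (∀ a, π (d a) = 0) ∧ (∀ b, ∃ a, d a = 0 ∧ π a = b) ∧
    (∀ a, d a = 0 → π a = 0 → ∃ c, d c = a)

/-- A cochain algebra `(A, d)` is formal if there is a quasi-isomorphism from `(A, d)` to a
ring with zero differential (its cohomology). -/
def IsFormalDGA {A : Type*} [Ring A] (d : A → A) : Prop :=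
  ∃ (T : Type) (_ : Ring T) (π : A →+* T), DGQuasiIsoToZero d π

section Koszul

variable {R M N : Type*} [CommRing R] [AddCommGroup M] [Module R M] [AddCommGroup N] [Module R N]

/-- The degree-one boundaries of the Koszul complex of a linear form `φ`. -/
def koszulBoundaries (φ : M →ₗ[R] R) : Submodule R M :=
  Submodule.span R (Set.range fun p : M × M => φ p.1 • p.2 - φ p.2 • p.1)

lemma mem_koszulBoundaries (φ : M →ₗ[R] R) (u v : M) :
    φ u • v - φ v • u ∈ koszulBoundaries φ :=
  Submodule.subset_span ⟨(u, v), rfl⟩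

lemma map_mem_koszulBoundaries (φ : M →ₗ[R] R) (χ : N →ₗ[R] R) (f : M →ₗ[R] N)
    (hf : ∀ x, χ (f x) = φ x) {x : M} (hx : x ∈ koszulBoundaries φ) :
    f x ∈ koszulBoundaries χ := by
  suffices koszulBoundaries φ ≤ (koszulBoundaries χ).comap f from this hx
  refine Submodule.span_le.2 ?_
  rintro _ ⟨⟨u, v⟩, rfl⟩
  simpa [hf] using mem_koszulBoundaries χ (f u) (f v)

/-- The first Koszul homology `ker φ / koszulBoundaries φ` is a retract of
`M / koszulBoundaries φ`. -/
def KoszulSplits (φ : M →ₗ[R] R) : Prop :=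
  ∃ c : M →ₗ[R] M, (∀ x, φ (c x) = 0) ∧ ∀ x, φ x = 0 → x - c x ∈ koszulBoundaries φ

lemma KoszulSplits.of_retract {φ : M →ₗ[R] R} {χ : N →ₗ[R] R} (h : KoszulSplits φ)
    (r : M →ₗ[R] N) (i : N →ₗ[R] M) (hr : ∀ x, χ (r x) = φ x) (hi : ∀ x, φ (i x) = χ x)
    (hri : ∀ x, r (i x) = x) : KoszulSplits χ := by
  obtain ⟨c, hc, hc'⟩ := h
  refine ⟨r ∘ₗ c ∘ₗ i, fun x => by simp [hr, hc], fun x hx => ?_⟩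
  have := map_mem_koszulBoundaries φ χ r hr (hc' (i x) (by rw [hi, hx]))
  simpa [hri] using this

/-- If the coefficients of all syzygies lie in `𝔪` and the Koszul homology splits off, then the
first Koszul homology `H` satisfies `H = 𝔪 H`. -/
lemma KoszulSplits.ker_le {ι : Type*} [Fintype ι] {φ : (ι → R) →ₗ[R] R} (h : KoszulSplits φ)
    (𝔪 : Ideal R) (hφ : ∀ a, φ a = 0 → ∀ i, a i ∈ 𝔪) :
    LinearMap.ker φ ≤ koszulBoundaries φ ⊔ 𝔪 • LinearMap.ker φ := by
  classical
  obtain ⟨c, hc, hc'⟩ := h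
  intro a ha
  rw [← sub_add_cancel a (c a)]
  refine add_mem (Submodule.mem_sup_left (hc' a ha)) (Submodule.mem_sup_right ?_)
  rw [pi_eq_sum_univ' a, map_sum]
  refine sum_mem fun i _ => ?_
  rw [map_smul]
  exact Submodule.smul_mem_smul (hφ a ha i) (hc _)

end Koszul

section ExteriorContraction

variable {R M N : Type*} [CommRing R] [AddCommGroup M] [Module R M] [AddCommGroup N] [Module R N]

namespace ExteriorAlgebra

/-- Contraction of the exterior algebra against a linear form. -/
def contract (φ : M →ₗ[R] R) : ExteriorAlgebra R M →ₗ[R] ExteriorAlgebra R M :=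
  CliffordAlgebra.contractLeft (Q := (0 : QuadraticForm R M)) φ

lemma contract_algebraMap (φ : M →ₗ[R] R) (r : R) :
    contract φ (algebraMap R (ExteriorAlgebra R M) r) = 0 :=
  CliffordAlgebra.contractLeft_algebraMap _ _ r

lemma contract_ι_mul (φ : M →ₗ[R] R) (x : M) (w : ExteriorAlgebra R M) :
    contract φ (ι R x * w) = φ x • w - ι R x * contract φ w :=
  CliffordAlgebra.contractLeft_ι_mul _ _ _

lemma contract_ι (φ : M →ₗ[R] R) (x : M) :
    contract φ (ι R x) = algebraMap R (ExteriorAlgebra R M) (φ x) :=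
  CliffordAlgebra.contractLeft_ι _ _ x

lemma left_induction {C : ExteriorAlgebra R M → Prop}
    (algebraMap : ∀ r : R, C (algebraMap _ _ r)) (add : ∀ x y, C x → C y → C (x + y))
    (ι_mul : ∀ w x, C w → C (ι R x * w)) (w : ExteriorAlgebra R M) : C w :=
  CliffordAlgebra.left_induction (Q := (0 : QuadraticForm R M)) algebraMap add ι_mul w

lemma ιInv_algebraMap (r : R) : ιInv (algebraMap R (ExteriorAlgebra R M) r) = 0 := by
  let : Module Rᵐᵒᵖ M := Module.compHom _ ((RingHom.id R).fromOpposite mul_comm)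
  have : IsCentralScalar R M := ⟨fun r m => rfl⟩
  simp [ιInv, TrivSqZeroExt.algebraMap_eq_inl]

lemma ιInv_ι_mul (x : M) (w : ExteriorAlgebra R M) : ιInv (ι R x * w) = algebraMapInv w • x := by
  let : Module Rᵐᵒᵖ M := Module.compHom _ ((RingHom.id R).fromOpposite mul_comm)
  have : IsCentralScalar R M := ⟨fun r m => rfl⟩
  have h : (TrivSqZeroExt.fstHom R R M).comp toTrivSqZeroExt = algebraMapInv := by
    ext
    simp [algebraMapInv]
  have hw : (toTrivSqZeroExt w).fst = algebraMapInv w := DFunLike.congr_fun h w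
  simp [ιInv, hw]

lemma algebraMapInv_contract (φ : M →ₗ[R] R) (w : ExteriorAlgebra R M) :
    algebraMapInv (contract φ w) = φ (ιInv w) := by
  induction w using left_induction with
  | algebraMap r => simp [contract_algebraMap, ιInv_algebraMap]
  | add x y hx hy => simp [hx, hy]
  | ι_mul w x _ => simp [contract_ι_mul, ιInv_ι_mul, algebraMapInv, mul_comm]

lemma ιInv_contract_mem (φ : M →ₗ[R] R) (w : ExteriorAlgebra R M) :
    ιInv (contract φ w) ∈ koszulBoundaries φ := by
  induction w using left_induction with
  | algebraMap r => simp [contract_algebraMap]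
  | add x y hx hy => simpa using add_mem hx hy
  | ι_mul w x _ =>
    simpa [contract_ι_mul, ιInv_ι_mul, algebraMapInv_contract] using
      mem_koszulBoundaries φ x (ιInv w)

lemma map_contract (φ : M →ₗ[R] R) (χ : N →ₗ[R] R) (f : M →ₗ[R] N)
    (hf : ∀ x, χ (f x) = φ x) (w : ExteriorAlgebra R M) :
    map f (contract φ w) = contract χ (map f w) := by
  induction w using left_induction with
  | algebraMap r => simp [contract_algebraMap, AlgHom.commutes]
  | add x y hx hy => simp [hx, hy]
  | ι_mul w x h => simp [contract_ι_mul, hf, h]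

/-- The algebra isomorphism of exterior algebras induced by a linear isomorphism. -/
def mapEquiv (e : M ≃ₗ[R] N) : ExteriorAlgebra R M ≃ₐ[R] ExteriorAlgebra R N :=
  AlgEquiv.ofAlgHom (map e.toLinearMap) (map e.symm.toLinearMap)
    (by rw [map_comp_map]; simp) (by rw [map_comp_map]; simp)

end ExteriorAlgebra

/-- Formality of the Koszul algebra of a linear form makes its first homology split off. -/
lemma IsFormalDGA.koszulSplits {ι : Type*} [Fintype ι] {φ : (ι → R) →ₗ[R] R}
    (h : IsFormalDGA (⇑(ExteriorAlgebra.contract φ))) : KoszulSplits φ := by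
  classical
  obtain ⟨T, _, π, hd, hsurj, hker⟩ := h
  choose y hy hy' using fun i : ι =>
    hsurj (π (ExteriorAlgebra.ι R (Pi.single i (1 : R))))
  let F : (ι → R) →ₗ[R] ExteriorAlgebra R (ι → R) := Fintype.linearCombination R y
  have hF : ∀ a, F a = ∑ i, a i • y i := Fintype.linearCombination_apply R y
  have hdF : ∀ a, ExteriorAlgebra.contract φ (F a) = 0 := fun a => by
    simp [hF, map_sum, hy]
  have hπF : ∀ a, π (F a) = π (ExteriorAlgebra.ι R a) := fun a => by
    conv_rhs => rw [pi_eq_sum_univ' a]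
    simp only [hF, map_sum, map_smul]
    simp only [Algebra.smul_def, map_mul, hy']
  refine ⟨ExteriorAlgebra.ιInv ∘ₗ F, fun a => ?_, fun a ha => ?_⟩
  · simp [← ExteriorAlgebra.algebraMapInv_contract, hdF]
  · obtain ⟨w, hw⟩ := hker (ExteriorAlgebra.ι R a - F a)
      (by simp [ExteriorAlgebra.contract_ι, ha, hdF]) (by simp [hπF])
    have := ExteriorAlgebra.ιInv_contract_mem φ w
    rw [hw, map_sub, ExteriorAlgebra.ι_leftInverse] at this
    exact this

end ExteriorContraction

section KoszulRegular

variable {R : Type*} [CommRing R]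

lemma exists_eq_of_mem_koszulBoundaries_succ {r : ℕ} (p : Fin (r + 1) → R)
    {b : Fin (r + 1) → R} (hb : b ∈ koszulBoundaries (Fintype.linearCombination R p)) :
    ∃ b' ∈ koszulBoundaries (Fintype.linearCombination R (Fin.init p)), ∃ y,
      Fin.init b = b' + p (Fin.last r) • y ∧
        b (Fin.last r) = -Fintype.linearCombination R (Fin.init p) y := by
  induction hb using Submodule.span_induction with
  | mem x hx =>
    obtain ⟨⟨u, v⟩, rfl⟩ := hx
    refine ⟨_, mem_koszulBoundaries _ (Fin.init u) (Fin.init v),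
      u (Fin.last r) • Fin.init v - v (Fin.last r) • Fin.init u, ?_, ?_⟩
    · ext i
      simp only [Fintype.linearCombination_apply, Fin.sum_univ_castSucc, Fin.init, Pi.add_apply,
        Pi.sub_apply, Pi.smul_apply, smul_eq_mul]
      ring
    · simp only [map_sub, map_smul, Fintype.linearCombination_apply, Fin.sum_univ_castSucc,
        Fin.init, Pi.sub_apply, Pi.smul_apply, smul_eq_mul]
      ring
  | zero => exact ⟨0, zero_mem _, 0, by ext; simp [Fin.init], by simp⟩
  | add x y _ _ hx hy =>
    obtain ⟨b₁, hb₁, y₁, h₁, h₁'⟩ := hx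
    obtain ⟨b₂, hb₂, y₂, h₂, h₂'⟩ := hy
    refine ⟨b₁ + b₂, add_mem hb₁ hb₂, y₁ + y₂, ?_, ?_⟩
    · have : Fin.init (x + y) = Fin.init x + Fin.init y := rfl
      rw [this, h₁, h₂, smul_add]
      abel
    · rw [Pi.add_apply, h₁', h₂', map_add, neg_add]
  | smul c x _ hx =>
    obtain ⟨b₁, hb₁, y₁, h₁, h₁'⟩ := hx
    refine ⟨c • b₁, Submodule.smul_mem _ _ hb₁, c • y₁, ?_, ?_⟩
    · have : Fin.init (c • x) = c • Fin.init x := rfl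
      rw [this, h₁, smul_add, smul_comm]
    · rw [Pi.smul_apply, h₁', map_smul, smul_neg]

lemma linearCombination_snoc {r : ℕ} (p : Fin (r + 1) → R) (z : Fin r → R) (a : R) :
    Fintype.linearCombination R p (Fin.snoc z a : Fin (r + 1) → R) =
      Fintype.linearCombination R (Fin.init p) z + a * p (Fin.last r) := by
  simp [Fintype.linearCombination_apply, Fin.sum_univ_castSucc, Fin.init]

/-- A finite sequence whose first Koszul homology `H` satisfies `H = 𝔪 H` is regular, provided
that the ideals generated by its members are saturated with respect to `1 + 𝔪`. -/
theorem isWeaklyRegular_of_ker_le_koszulBoundaries [IsNoetherianRing R] (𝔪 : Ideal R) {r : ℕ}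
    (p : Fin r → R) (hp : ∀ i, p i ∈ 𝔪)
    (hsat : ∀ (s : Set (Fin r)) (e a : R), e - 1 ∈ 𝔪 → e * a ∈ Ideal.span (p '' s) →
      a ∈ Ideal.span (p '' s))
    (h : LinearMap.ker (Fintype.linearCombination R p) ≤
      koszulBoundaries (Fintype.linearCombination R p) ⊔
        𝔪 • LinearMap.ker (Fintype.linearCombination R p)) :
    RingTheory.Sequence.IsWeaklyRegular R (List.ofFn p) ∧
      ringKrullDim (R ⧸ Ideal.span (Set.range p)) + r ≤ ringKrullDim R := by
  induction r with
  | zero =>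
    refine ⟨by simp, ?_⟩
    simpa using ringKrullDim_quotient_le (R := R) (Ideal.span (Set.range p))
  | succ r ih =>
    obtain ⟨e, he, heB⟩ := Submodule.exists_sub_one_mem_and_smul_le_of_fg_of_le_sup
      (IsNoetherian.noetherian _) le_rfl h
    have key : ∀ z a, Fintype.linearCombination R (Fin.init p) z + a * p (Fin.last r) = 0 →
        ∃ b' ∈ koszulBoundaries (Fintype.linearCombination R (Fin.init p)), ∃ y,
          e • z = b' + p (Fin.last r) • y ∧
            e * a = -Fintype.linearCombination R (Fin.init p) y := by
      intro z a hz
      have hmem := heB (Submodule.smul_mem_pointwise_smul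
        (Fin.snoc z a : Fin (r + 1) → R) e _ (by
          rw [LinearMap.mem_ker, linearCombination_snoc, hz]))
      obtain ⟨b', hb', y, hy, hy'⟩ := exists_eq_of_mem_koszulBoundaries_succ p hmem
      refine ⟨b', hb', y, ?_, ?_⟩
      · rw [← hy]
        ext i
        simp [Fin.init]
      · rw [← hy']
        simp
    have himage : ∀ s : Set (Fin r), Fin.init p '' s = p '' (Fin.castSucc '' s) := fun s => by
      rw [Set.image_image]
      rfl
    obtain ⟨hreg, hdim⟩ := ih (Fin.init p) (fun i => hp _)
      (fun s e a he ha => by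
        rw [himage] at ha ⊢
        exact hsat _ e a he ha)
      (fun z hz => by
        obtain ⟨b', hb', y, hy, hy'⟩ := key z 0 (by simpa using hz)
        have hzz : z = b' + (p (Fin.last r) • y + (-(e - 1)) • z) := by
          rw [← add_assoc, ← hy]
          module
        rw [hzz]
        refine add_mem (Submodule.mem_sup_left hb') (Submodule.mem_sup_right (add_mem ?_ ?_))
        · refine Submodule.smul_mem_smul (hp _) ?_
          rw [LinearMap.mem_ker]
          simpa using hy'.symm
        · exact Submodule.smul_mem_smul (neg_mem he) hz)
    have hnzd : ∀ a, p (Fin.last r) * a ∈ Ideal.span (Set.range (Fin.init p)) →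
        a ∈ Ideal.span (Set.range (Fin.init p)) := by
      intro a ha
      obtain ⟨b, hb⟩ := (Submodule.mem_span_range_iff_exists_fun R).1 ha
      obtain ⟨-, -, y, -, hy⟩ := key (-b) a (by
        rw [map_neg, Fintype.linearCombination_apply, hb]
        ring)
      rw [← Set.image_univ, himage]
      refine hsat _ e a he ?_
      rw [← himage, Set.image_univ, hy]
      refine neg_mem ((Submodule.mem_span_range_iff_exists_fun R).2 ⟨y, ?_⟩)
      rw [Fintype.linearCombination_apply]
    constructor
    · rw [List.ofFn_succ', List.concat_eq_append,
        RingTheory.Sequence.isWeaklyRegular_append_iff]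
      refine ⟨hreg, ?_⟩
      rw [RingTheory.Sequence.isWeaklyRegular_singleton_iff,
        isSMulRegular_quotient_iff_mem_of_smul_mem]
      have hlist : Ideal.ofList (List.ofFn fun i : Fin r => p i.castSucc) =
          Ideal.span (Set.range (Fin.init p)) := by
        rw [Ideal.ofList]
        congr 1
        ext x
        simp [List.mem_ofFn, Fin.init]
      intro a ha
      rw [hlist, smul_eq_mul, Ideal.mul_top] at ha ⊢
      exact hnzd a ha
    · have hle : Ideal.span (Set.range (Fin.init p)) ≤ Ideal.span (Set.range p) := by
        refine Ideal.span_mono ?_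
        rintro _ ⟨i, rfl⟩
        exact ⟨_, rfl⟩
      have := ringKrullDim_succ_le_of_surjective (Ideal.Quotient.factor hle)
        (Ideal.Quotient.factor_surjective hle)
        (r := Ideal.Quotient.mk _ (p (Fin.last r))) (by
          rw [mem_nonZeroDivisors_iff_left]
          intro x hx
          obtain ⟨a, rfl⟩ := Ideal.Quotient.mk_surjective x
          rw [← map_mul, Ideal.Quotient.eq_zero_iff_mem] at hx
          exact Ideal.Quotient.eq_zero_iff_mem.2 (hnzd a hx))
        (by
          rw [Ideal.Quotient.factor_mk, Ideal.Quotient.eq_zero_iff_mem]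
          exact Ideal.subset_span ⟨_, rfl⟩)
      refine le_trans ?_ hdim
      rw [Nat.cast_succ, add_comm (r : WithBot ℕ∞) 1, ← add_assoc]
      gcongr

end KoszulRegular

section WeightedHomogeneous

variable {σ K : Type*} [Field K] {w : σ → ℕ}

attribute [local instance] MvPolynomial.weightedGradedAlgebra

lemma weightedHomogeneousComponent_mul (a b : MvPolynomial σ K) (d : ℕ) :
    weightedHomogeneousComponent w d (a * b) =
      ∑ ij ∈ Finset.HasAntidiagonal.antidiagonal d,
        weightedHomogeneousComponent w ij.1 a * weightedHomogeneousComponent w ij.2 b := by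
  have h : ∀ (f : MvPolynomial σ K) (d : ℕ), weightedHomogeneousComponent w d f =
      (DirectSum.decompose (weightedHomogeneousSubmodule K w) f d : MvPolynomial σ K) :=
    fun f d => (weightedDecomposition.decompose'_apply K w f d).symm
  simp only [h, DirectSum.decompose_mul]
  exact DirectSum.coe_mul_apply_eq_sum_antidiagonal (A := weightedHomogeneousSubmodule K w) _ _ d

lemma mem_of_mul_mem_of_isHomogeneous (hw : ∀ i, w i ≠ 0) {J : Ideal (MvPolynomial σ K)}
    (hJ : J.IsHomogeneous (weightedHomogeneousSubmodule K w)) {e a : MvPolynomial σ K}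
    (he : constantCoeff e ≠ 0) (h : e * a ∈ J) : a ∈ J := by
  rw [mem_iff_weightedHomogeneousComponent_mem K w hJ]
  intro d
  induction d using Nat.strong_induction_on with
  | _ d ih =>
    have hd := weightedHomogeneousComponent_mem_of_mem K w hJ h d
    rw [weightedHomogeneousComponent_mul, ← Finset.add_sum_erase _ _
      (show ((0, d) : ℕ × ℕ) ∈ Finset.HasAntidiagonal.antidiagonal d by simp)] at hd
    rw [Ideal.add_mem_iff_left] at hd
    · rw [weightedHomogeneousComponent_zero e hw] at hd
      have := J.mul_mem_left (C (constantCoeff e)⁻¹) hd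
      rwa [← mul_assoc, ← C_mul, ← constantCoeff_eq, inv_mul_cancel₀ he, C_1, one_mul] at this
    · refine sum_mem fun ij hij => J.mul_mem_left _ (ih _ ?_)
      simp only [Finset.mem_erase, Finset.HasAntidiagonal.mem_antidiagonal, ne_eq,
        Prod.ext_iff] at hij
      lia

lemma isHomogeneous_span_image {ι : Type*} {p : ι → MvPolynomial σ K}
    (hp : ∀ i, ∃ d : ℕ, (p i).IsWeightedHomogeneous w d) (s : Set ι) :
    (Ideal.span (p '' s)).IsHomogeneous (weightedHomogeneousSubmodule K w) := by
  refine Ideal.homogeneous_span _ _ ?_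
  rintro _ ⟨i, -, rfl⟩
  obtain ⟨d, hd⟩ := hp i
  exact ⟨d, hd⟩

end WeightedHomogeneous

lemma MvPolynomial.natCast_le_height_of_isMaximal {K : Type*} [Field K] {n : ℕ}
    (M : Ideal (MvPolynomial (Fin n) K)) [hM : M.IsMaximal] : (n : ℕ∞) ≤ M.height := by
  induction n with
  | zero => simp
  | succ n ih =>
    let e := (finSuccEquiv K n).toRingEquiv
    have : (M.map e).IsMaximal := Ideal.map_isMaximal_of_equiv e
    have : ((M.map e).comap Polynomial.C).IsMaximal :=
      Polynomial.isMaximal_comap_C_of_isJacobsonRing _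
    have : (M.map e).LiesOver ((M.map e).comap Polynomial.C) := ⟨rfl⟩
    rw [← e.height_map M, Polynomial.height_eq_height_add_one ((M.map e).comap Polynomial.C)]
    push_cast
    gcongr
    exact ih _

section Generators

variable {R : Type*} [CommRing R]

/-- Splitting off a minimal generating subfamily of a finite family. -/
lemma exists_equiv_sum_minimal_span {m : ℕ} (P : Fin m → R) :
    ∃ (r k : ℕ) (σ : Fin m ≃ Fin r ⊕ Fin k),
      Ideal.span (Set.range fun i => P (σ.symm (.inl i))) = Ideal.span (Set.range P) ∧
        ∀ i, P (σ.symm (.inl i)) ∉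
          Ideal.span ((fun i => P (σ.symm (.inl i))) '' ({i}ᶜ : Set (Fin r))) := by
  classical
  obtain ⟨S, hS⟩ := exists_minimal_of_wellFoundedLT
    (fun S : Finset (Fin m) => Ideal.span (P '' S) = Ideal.span (Set.range P))
    ⟨Finset.univ, by simp⟩
  let σ : Fin m ≃ Fin (Fintype.card {j // j ∈ S}) ⊕ Fin (Fintype.card {j // j ∉ S}) :=
    (Equiv.sumCompl (· ∈ S)).symm.trans
      ((Fintype.equivFin _).sumCongr (Fintype.equivFin _))
  have hσ : ∀ i, σ.symm (.inl i) = ((Fintype.equivFin {j // j ∈ S}).symm i : Fin m) :=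
    fun i => by simp [σ]
  refine ⟨_, _, σ, ?_, fun i hi => ?_⟩
  · rw [← hS.prop]
    congr 1
    ext x
    simp only [hσ, Set.mem_range, Set.mem_image, SetLike.mem_coe]
    constructor
    · rintro ⟨i, rfl⟩
      exact ⟨_, Subtype.prop _, rfl⟩
    · rintro ⟨j, hj, rfl⟩
      exact ⟨Fintype.equivFin {j // j ∈ S} ⟨j, hj⟩, by simp⟩
  · set j := (Fintype.equivFin {j // j ∈ S}).symm i with hj
    have hsub : (fun i => P (σ.symm (.inl i))) '' {i}ᶜ ⊆ P '' (S.erase j : Finset (Fin m)) := by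
      rintro _ ⟨i', hi', rfl⟩
      refine ⟨_, ?_, rfl⟩
      rw [hσ, SetLike.mem_coe, Finset.mem_erase]
      refine ⟨fun h => hi' ?_, Subtype.prop _⟩
      exact (Fintype.equivFin _).symm.injective (Subtype.ext h)
    have hmem : P j ∈ Ideal.span (P '' (S.erase j : Finset (Fin m))) := by
      have := Ideal.span_mono hsub hi
      rwa [hσ] at this
    have hspan : Ideal.span (P '' (S.erase j : Finset (Fin m))) = Ideal.span (Set.range P) := by
      rw [← hS.prop]
      refine le_antisymm (Ideal.span_mono (Set.image_mono (by simp))) (Ideal.span_le.2 ?_)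
      rintro _ ⟨l, hl, rfl⟩
      by_cases hlj : l = j
      · rw [hlj]
        exact hmem
      · exact Ideal.subset_span ⟨l, by simpa [hlj] using hl, rfl⟩
    have := hS.le_of_le hspan (Finset.erase_subset _ _) j.2
    simp at this

variable {ι α β : Type*} [Fintype ι] [Fintype α] [Fintype β]

lemma linearCombination_equiv_sum (σ : ι ≃ α ⊕ β) (P a : ι → R) :
    Fintype.linearCombination R P a =
      Fintype.linearCombination R (fun i => P (σ.symm (.inl i))) (fun i => a (σ.symm (.inl i))) +
        ∑ l, a (σ.symm (.inr l)) * P (σ.symm (.inr l)) := by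
  simp only [Fintype.linearCombination_apply, smul_eq_mul]
  rw [← Equiv.sum_comp σ.symm, Fintype.sum_sum_type]

/-- If the members of `P` indexed by `β` lie in the ideal generated by those indexed by `α`, a
change of basis replaces them by zero. -/
lemma exists_linearEquiv_of_span_eq (σ : ι ≃ α ⊕ β) (P : ι → R)
    (h : Ideal.span (Set.range fun i => P (σ.symm (.inl i))) = Ideal.span (Set.range P)) :
    (∃ e : (ι → R) ≃ₗ[R] (ι → R), ∀ a,
      Fintype.linearCombination R (fun j => (σ j).elim (fun i => P (σ.symm (.inl i))) 0) (e a) =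
        Fintype.linearCombination R P a) ∧
    (KoszulSplits (Fintype.linearCombination R P) →
      KoszulSplits (Fintype.linearCombination R fun i => P (σ.symm (.inl i)))) := by
  have hmem : ∀ l, ∃ t : α → R,
      Fintype.linearCombination R (fun i => P (σ.symm (.inl i))) t = P (σ.symm (.inr l)) := by
    intro l
    have : P (σ.symm (.inr l)) ∈ Ideal.span (Set.range fun i => P (σ.symm (.inl i))) := by
      rw [h]
      exact Ideal.subset_span ⟨_, rfl⟩
    exact (Submodule.mem_span_range_iff_exists_fun R).1 this
  choose t ht using hmem
  let u : (ι → R) →ₗ[R] (α → R) := ∑ l, (LinearMap.proj (σ.symm (.inr l))).smulRight (t l)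
  let pr : (ι → R) →ₗ[R] (α → R) := LinearMap.funLeft R R fun i => σ.symm (.inl i)
  let inc : (α → R) →ₗ[R] (ι → R) :=
    LinearMap.pi fun j => (σ j).elim (fun i => LinearMap.proj i) fun _ => 0
  have hu : ∀ a, u a = ∑ l, a (σ.symm (.inr l)) • t l := fun a => by simp [u]
  have hpr : ∀ a i, pr a i = a (σ.symm (.inl i)) := fun a i => rfl
  have hincl : ∀ b i, inc b (σ.symm (.inl i)) = b i := fun b i => by simp [inc]
  have hincr : ∀ b l, inc b (σ.symm (.inr l)) = 0 := fun b i => by simp [inc]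
  have huinc : ∀ b, u (inc b) = 0 := fun b => by simp [hu, hincr]
  have hprinc : ∀ b, pr (inc b) = b := fun b => by
    ext i
    rw [hpr, hincl]
  have hφ : ∀ a, Fintype.linearCombination R (fun i => P (σ.symm (.inl i))) (pr a + u a) =
      Fintype.linearCombination R P a := fun a => by
    rw [linearCombination_equiv_sum σ P a, map_add, hu, map_sum]
    simp only [map_smul, ht, smul_eq_mul]
    rfl
  constructor
  · refine ⟨LinearEquiv.ofLinearMap (LinearMap.id + inc ∘ₗ u) (LinearMap.id - inc ∘ₗ u) ?_ ?_,
      fun a => ?_⟩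
    · ext1 a
      ext1 a
      simp [huinc]
    · ext1 a
      ext1 a
      simp [huinc]
    · rw [← hφ, linearCombination_equiv_sum σ]
      simp only [Equiv.apply_symm_apply, Sum.elim_inl, Sum.elim_inr, Pi.zero_apply, mul_zero,
        Finset.sum_const_zero, add_zero]
      congr 1
      ext i
      simp [hincl, hpr]
  · intro hs
    refine hs.of_retract (pr + u) inc hφ (fun b => ?_) fun b => ?_
    · rw [← hφ, hprinc, huinc, add_zero]
    · rw [LinearMap.add_apply, hprinc, huinc, add_zero]

end Generators

lemma pureDiff_eq_contract (P : Fin m → MvPolynomial (Fin n) ℚ) :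
    pureDiff n m P = ExteriorAlgebra.contract
      (Fintype.linearCombination (MvPolynomial (Fin n) ℚ) P) := by
  unfold pureDiff ExteriorAlgebra.contract
  congr 1
  refine LinearMap.ext fun a => ?_
  simp [Fintype.linearCombination_apply, mul_comm]

/-- A minimal family of homogeneous generators of an ideal of finite colength is a regular
sequence of maximal length as soon as its first Koszul homology splits off. -/
theorem isRegular_of_koszulSplits {n r : ℕ} {K : Type*} [Field K] {w : Fin n → ℕ}
    (hw : ∀ i, w i ≠ 0) (p : Fin r → MvPolynomial (Fin n) K)
    (hhom : ∀ i, ∃ d : ℕ, (p i).IsWeightedHomogeneous w d)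
    (hconst : ∀ i, constantCoeff (p i) = 0)
    (hfd : FiniteDimensional K (MvPolynomial (Fin n) K ⧸ Ideal.span (Set.range p)))
    (hmin : ∀ i, p i ∉ Ideal.span (p '' {i}ᶜ))
    (h : KoszulSplits (Fintype.linearCombination (MvPolynomial (Fin n) K) p)) :
    r = n ∧ RingTheory.Sequence.IsRegular (MvPolynomial (Fin n) K) (List.ofFn p) := by
  classical
  set I := Ideal.span (Set.range p) with hI
  let 𝔪 : Ideal (MvPolynomial (Fin n) K) :=
    RingHom.ker (constantCoeff : MvPolynomial (Fin n) K →+* K)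
  have hmax : 𝔪.IsMaximal :=
    RingHom.ker_isMaximal_of_surjective _ fun x => ⟨C x, constantCoeff_C _ x⟩
  have hIle : I ≤ 𝔪 := by
    rw [hI, Ideal.span_le]
    rintro _ ⟨i, rfl⟩
    exact hconst i
  have hsyz : ∀ a, Fintype.linearCombination (MvPolynomial (Fin n) K) p a = 0 →
      ∀ i, a i ∈ 𝔪 := by
    intro a ha i
    by_contra hai
    refine hmin i (mem_of_mul_mem_of_isHomogeneous hw (isHomogeneous_span_image hhom _)
      (e := a i) hai ?_)
    rw [Fintype.linearCombination_apply, ← Finset.add_sum_erase _ _ (Finset.mem_univ i),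
      smul_eq_mul] at ha
    rw [eq_neg_of_add_eq_zero_left ha]
    refine neg_mem (sum_mem fun j hj => Ideal.mul_mem_left _ _ (Ideal.subset_span ⟨j, ?_, rfl⟩))
    simpa using hj
  obtain ⟨hreg, hdim⟩ := isWeaklyRegular_of_ker_le_koszulBoundaries 𝔪 p hconst
    (fun s e a he ha => mem_of_mul_mem_of_isHomogeneous hw (isHomogeneous_span_image hhom s)
      (by
        rw [RingHom.mem_ker, map_sub, map_one, sub_eq_zero] at he
        rw [he]
        exact one_ne_zero) ha)
    (h.ker_le 𝔪 hsyz)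
  have : Nontrivial (MvPolynomial (Fin n) K ⧸ I) :=
    Ideal.Quotient.nontrivial_iff.2 (ne_top_of_le_ne_top hmax.ne_top hIle)
  have : IsArtinianRing (MvPolynomial (Fin n) K ⧸ I) := .of_finite K _
  have hzero : ringKrullDim (MvPolynomial (Fin n) K ⧸ I) = 0 :=
    ringKrullDimZero_iff_ringKrullDim_eq_zero.1 inferInstance
  have hle : r ≤ n := by
    rw [hzero, zero_add, MvPolynomial.ringKrullDim_of_isNoetherianRing,
      ringKrullDim_eq_zero_of_field, zero_add, Nat.card_eq_fintype_card, Fintype.card_fin] at hdim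
    exact_mod_cast hdim
  have hge : n ≤ r := by
    have hmem : 𝔪 ∈ I.minimalPrimes := by
      have : Ring.KrullDimLE 0 (MvPolynomial (Fin n) K ⧸ I) := inferInstance
      refine ⟨⟨hmax.isPrime, hIle⟩, ?_⟩
      rintro q ⟨hq, hIq⟩ hqm
      have : (q.map (Ideal.Quotient.mk I)).IsPrime :=
        Ideal.map_isPrime_of_surjective Ideal.Quotient.mk_surjective (by simpa using hIq)
      have hmq : (q.map (Ideal.Quotient.mk I)).IsMaximal := inferInstance
      have := Ideal.comap_isMaximal_of_surjective (Ideal.Quotient.mk I)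
        Ideal.Quotient.mk_surjective (K := q.map (Ideal.Quotient.mk I))
      rw [Ideal.comap_map_of_surjective _ Ideal.Quotient.mk_surjective, ← RingHom.ker_eq_comap_bot,
        Ideal.mk_ker, sup_eq_left.2 hIq] at this
      exact (this.eq_of_le hmax.ne_top hqm).ge
    rw [hI, ← Set.image_univ, ← Finset.coe_univ, ← Finset.coe_image] at hmem
    have h₁ := Ideal.height_le_card_of_mem_minimalPrimes_span_finset hmem
    have h₂ := natCast_le_height_of_isMaximal 𝔪
    have h₃ : n ≤ (Finset.univ.image p).card := by exact_mod_cast h₂.trans h₁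
    exact h₃.trans (Finset.card_image_le.trans (by simp))
  refine ⟨le_antisymm hle hge, hreg, ?_⟩
  rw [smul_eq_mul, Ideal.mul_top, Ideal.ofList]
  refine (ne_top_of_le_ne_top hmax.ne_top (le_trans (le_of_eq ?_) hIle)).symm
  rw [hI]
  congr 1
  ext x
  simp [List.mem_ofFn]

/-- **Structure theorem for formal pure minimal Sullivan algebras** (Proposition 2.3):
a pure minimal Sullivan algebra `(ΛV, d)` (with `V` finite dimensional, generators of the
even part in positive even degrees, differential of the odd generators given by homogeneous
polynomials `Pⱼ` with no linear term) with finite-dimensional cohomology which is formal is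
isomorphic, as a cochain algebra, to a tensor product `(ΛV′, d) ⊗ (Λ⟨x₁,…,xₖ⟩, 0)` where
`(ΛV′, d)` is elliptic of positive Euler characteristic (its `n` even generators match `n`
odd generators whose differentials form a regular sequence) and the remaining `k` odd
generators have vanishing differential. -/
theorem formal_pure_sullivan_structure
    (w : Fin n → ℕ) (hw : ∀ i, Even (w i) ∧ 0 < w i)
    (P : Fin m → MvPolynomial (Fin n) ℚ)
    (hhom : ∀ j, ∃ d : ℕ, Even d ∧ 0 < d ∧ (P j).IsWeightedHomogeneous w d)
    (hmin : ∀ j, P j ∈ (Ideal.span (Set.range (X : Fin n → MvPolynomial (Fin n) ℚ))) ^ 2)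
    (hfd : FiniteDimensional ℚ (MvPolynomial (Fin n) ℚ ⧸ Ideal.span (Set.range P)))
    (hformal : IsFormalDGA (⇑(pureDiff n m P))) :
    ∃ (k : ℕ), m = n + k ∧
      ∃ (ψ : PureSullivanAlgebra n m ≃+* PureSullivanAlgebra n m)
        (P' : Fin m → MvPolynomial (Fin n) ℚ) (σ : Fin m ≃ (Fin n ⊕ Fin k)),
        (∀ a, ψ (pureDiff n m P a) = pureDiff n m P' (ψ a)) ∧
        (∀ j i, σ j = Sum.inr i → P' j = 0) ∧
        RingTheory.Sequence.IsRegular (MvPolynomial (Fin n) ℚ)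
          (List.ofFn fun i : Fin n => P' (σ.symm (Sum.inl i))) := by
  obtain ⟨r, k, σ, hspan, hmin'⟩ := exists_equiv_sum_minimal_span P
  obtain ⟨⟨e, he⟩, hsplit⟩ := exists_linearEquiv_of_span_eq σ P hspan
  rw [pureDiff_eq_contract] at hformal
  have hconst : ∀ j, constantCoeff (P j) = 0 := fun j => by
    obtain ⟨d, -, hd, hPd⟩ := hhom j
    rw [constantCoeff_eq]
    exact hPd.coeff_eq_zero 0 (by simpa using hd.ne)
  obtain ⟨rfl, hreg⟩ := isRegular_of_koszulSplits (fun i => (hw i).2.ne')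
    (fun i => P (σ.symm (.inl i)))
    (fun i => (hhom _).imp fun d hd => hd.2.2) (fun i => hconst _) (by rwa [hspan]) hmin'
    (hsplit hformal.koszulSplits)
  refine ⟨k, by simpa using Fintype.card_congr σ, (ExteriorAlgebra.mapEquiv e).toRingEquiv,
    fun j => (σ j).elim (fun i => P (σ.symm (.inl i))) 0, σ, fun a => ?_, fun j i hj => ?_, ?_⟩
  · rw [pureDiff_eq_contract, pureDiff_eq_contract]
    exact ExteriorAlgebra.map_contract _ _ e.toLinearMap he a
  · simp [hj]
  · simpa using hreg
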